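/- Let A and B be compact subsets of ℝ with λ(A) > 0 and λ(B) > 0, and let K be the unique positive integer such that K(K−1)/2 ≤ λ(A)/λ(B) < K(K+1)/2. Then λ(A + B) ≥ λ(A) + min(diam(B), K·λ(B)), where diam(B) = max(B) − min(B). -/

import Mathlib

open MeasureTheory Pointwise Set

section Residues

/-- The number of elements of `S` in the residue class `r` modulo `p`. -/
def residueCount (p : ℕ) (S : Finset ℤ) (r : ZMod p) : ℕ :=
  (S.filter fun s : ℤ => (s : ZMod p) = r).card

lemma sum_residueCount (p : ℕ) [NeZero p] (S : Finset ℤ) :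
    ∑ r, residueCount p S r = S.card :=
  (Finset.card_eq_sum_card_fiberwise fun _ _ => Finset.mem_coe.2 (Finset.mem_univ _)).symm

lemma residueCount_le_add {p : ℕ} {A B : Finset ℤ} {b : ℤ} (hb : b ∈ B) (r : ZMod p) :
    residueCount p A r ≤ residueCount p (A + B) (r + b) := by
  refine Finset.card_le_card_of_injOn (fun a => a + b) (fun a ha => ?_)
    (add_left_injective b).injOn
  simp only [Finset.coe_filter, mem_ofPred_eq] at ha ⊢
  exact ⟨Finset.add_mem_add ha.1 hb, by push_cast; rw [ha.2]⟩

lemma residueCount_lt_add {p : ℕ} [NeZero p] {A B : Finset ℤ} (h0 : (0 : ℤ) ∈ B)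
    (hp : (p : ℤ) ∈ B) {r : ZMod p} (hr : 0 < residueCount p A r) :
    residueCount p A r < residueCount p (A + B) r := by
  have hp0 : (p : ℤ) ≠ 0 := by exact_mod_cast NeZero.ne p
  have hcd := cauchy_davenport_add_of_linearOrder_isCancelAdd (Finset.card_pos.1 hr)
    (Finset.insert_nonempty (0 : ℤ) {(p : ℤ)})
  rw [Finset.card_pair hp0.symm] at hcd
  have hsub : (A.filter fun s : ℤ => (s : ZMod p) = r) + {0, (p : ℤ)} ⊆
      (A + B).filter fun s : ℤ => (s : ZMod p) = r := by
    intro s hs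
    obtain ⟨a, ha, b, hb, rfl⟩ := Finset.mem_add.1 hs
    rw [Finset.mem_filter] at ha ⊢
    rcases Finset.mem_insert.1 hb with rfl | hb
    · exact ⟨Finset.add_mem_add ha.1 h0, by simpa using ha.2⟩
    · rw [Finset.mem_singleton] at hb
      subst hb
      exact ⟨Finset.add_mem_add ha.1 hp, by simpa using ha.2⟩
  have := Finset.card_le_card hsub
  unfold residueCount
  omega

lemma sum_card_superlevel {ι : Type*} [Fintype ι] (c : ι → ℕ) (n : ℕ) :
    ∑ j ∈ Finset.range n, (Finset.univ.filter fun r => j < c r).card = ∑ r, min n (c r) := by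
  refine (Finset.sum_card_bipartiteAbove_eq_sum_card_bipartiteBelow
    (fun r j => j < c r) (s := Finset.univ) (t := Finset.range n)).symm.trans ?_
  refine Finset.sum_congr rfl fun r _ => ?_
  rw [← Finset.card_range (min n (c r))]
  congr 1
  ext j
  simp [Finset.bipartiteAbove]

lemma weighted_sum_le {f g : ℕ → ℝ} {β : ℝ} (m : ℕ) (hfg : ∀ j < m, g j + β ≤ f j)
    (hshift : ∀ j < m, g j ≤ f (j + 1)) :
    (m + 1) * ∑ j ∈ Finset.range m, g j + m * (m + 1) / 2 * β ≤
      m * ∑ j ∈ Finset.range (m + 1), f j := by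
  have hgauss : ∀ n : ℕ, ∑ j ∈ Finset.range n, ((m : ℝ) - j) = n * m - n * (n - 1) / 2 := by
    intro n
    induction n with
    | zero => simp
    | succ n ih => rw [Finset.sum_range_succ, ih]; push_cast; ring
  have hsplit : m * ∑ j ∈ Finset.range (m + 1), f j =
      ∑ j ∈ Finset.range m, (((m : ℝ) - j) * f j + (j + 1) * f (j + 1)) := by
    have h1 : ∑ j ∈ Finset.range (m + 1), ((m : ℝ) - j) * f j =
        ∑ j ∈ Finset.range m, ((m : ℝ) - j) * f j := by
      rw [Finset.sum_range_succ]; simp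
    have h2 : ∑ j ∈ Finset.range (m + 1), (j : ℝ) * f j =
        ∑ j ∈ Finset.range m, ((j : ℝ) + 1) * f (j + 1) := by
      rw [Finset.sum_range_succ']; simp
    rw [Finset.sum_add_distrib, ← h1, ← h2, ← Finset.sum_add_distrib, Finset.mul_sum]
    exact Finset.sum_congr rfl fun j _ => by ring
  have hlow : (m + 1) * ∑ j ∈ Finset.range m, g j + m * (m + 1) / 2 * β =
      ∑ j ∈ Finset.range m, (((m : ℝ) - j) * (g j + β) + (j + 1) * g j) := by
    have : ∀ j ∈ Finset.range m, ((m : ℝ) - j) * (g j + β) + (j + 1) * g j =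
        (m + 1) * g j + ((m : ℝ) - j) * β := fun j _ => by ring
    rw [Finset.sum_congr rfl this, Finset.sum_add_distrib, ← Finset.mul_sum, ← Finset.sum_mul,
      hgauss]
    ring
  rw [hsplit, hlow]
  refine Finset.sum_le_sum fun j hj => ?_
  rw [Finset.mem_range] at hj
  have hj' : (j : ℝ) ≤ m := by exact_mod_cast hj.le
  exact add_le_add (mul_le_mul_of_nonneg_left (hfg j hj) (by linarith))
    (mul_le_mul_of_nonneg_left (hshift j hj) (by positivity))

/-- A discrete analogue of Ruzsa's inequality. -/
lemma card_add_min_le_card_add {p : ℕ} (hp : p.Prime) {A B : Finset ℤ} (hA : A.Nonempty)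
    (hB : B ⊆ Finset.Icc 0 (p : ℤ)) (h0 : (0 : ℤ) ∈ B) (hpB : (p : ℤ) ∈ B) (K : ℕ) {β : ℝ}
    (hβ0 : 0 ≤ β) (hβ : β + 2 ≤ B.card) (hK : K * (K - 1) / 2 * β ≤ A.card) :
    A.card + min (p : ℝ) (K * β) ≤ (A + B).card := by
  have : NeZero p := ⟨hp.ne_zero⟩
  by_cases hfull : ∀ r, 0 < residueCount p (A + B) r
  · have hle : ∀ r, residueCount p A r + 1 ≤ residueCount p (A + B) r := by
      intro r
      rcases Nat.eq_zero_or_pos (residueCount p A r) with h | h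
      · rw [h]; exact hfull r
      · exact residueCount_lt_add h0 hpB h
    have hsum := Finset.sum_le_sum fun r (_ : r ∈ Finset.univ) => hle r
    rw [Finset.sum_add_distrib, sum_residueCount, sum_residueCount] at hsum
    have hsum' : A.card + p ≤ (A + B).card := by simpa [ZMod.card] using hsum
    have : (A.card : ℝ) + p ≤ (A + B).card := by exact_mod_cast hsum'
    linarith [min_le_left (p : ℝ) (K * β)]
  · push Not at hfull
    obtain ⟨r₀, hr₀⟩ := hfull
    set a := residueCount p A with ha
    set s := residueCount p (A + B) with hs
    obtain ⟨r₁, -, hr₁⟩ := Finset.exists_max_image Finset.univ a Finset.univ_nonempty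
    set m := a r₁ with hm
    have hmpos : 0 < m := by
      obtain ⟨x, hx⟩ := hA
      exact lt_of_lt_of_le (Finset.card_pos.2 ⟨x, by simpa using hx⟩)
        (hr₁ (x : ZMod p) (Finset.mem_univ _))
    set b : Finset (ZMod p) := B.image fun x : ℤ => (x : ZMod p) with hb
    have hbcard : B.card ≤ b.card + 1 := by
      have hinj : Set.InjOn (fun x : ℤ => (x : ZMod p)) (B.erase (p : ℤ)) := by
        intro x hx y hy hxy
        rw [Finset.coe_erase] at hx hy
        have hx1 := Finset.mem_Icc.1 (hB hx.1)
        have hy1 := Finset.mem_Icc.1 (hB hy.1)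
        have hx2 : x ≠ p := hx.2
        have hy2 : y ≠ p := hy.2
        have hmod := (ZMod.intCast_eq_intCast_iff' x y p).1 hxy
        rwa [Int.emod_eq_of_lt hx1.1 (by omega), Int.emod_eq_of_lt hy1.1 (by omega)] at hmod
      have h1 := Finset.card_image_of_injOn hinj
      have h2 : ((B.erase (p : ℤ)).image fun x : ℤ => (x : ZMod p)).card ≤ b.card :=
        Finset.card_le_card (Finset.image_subset_image (Finset.erase_subset _ _))
      have h3 := Finset.card_erase_add_one hpB
      omega
    have hbne : b.Nonempty := ⟨_, Finset.mem_image_of_mem _ h0⟩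
    have hlevel : ∀ j < m, ((Finset.univ.filter fun r => j < a r).card : ℝ) + β ≤
        (Finset.univ.filter fun r => j < s r).card := by
      intro j hj
      have hcd := ZMod.cauchy_davenport hp
        (s := Finset.univ.filter fun r => j < a r) ⟨r₁, by simpa using hj⟩ hbne
      have hsub : (Finset.univ.filter fun r => j < a r) + b ⊆
          Finset.univ.filter fun r => j < s r := by
        intro t ht
        obtain ⟨r, hr, _, hyb, rfl⟩ := Finset.mem_add.1 ht
        obtain ⟨y, hy, rfl⟩ := Finset.mem_image.1 hyb
        simp only [Finset.mem_filter, Finset.mem_univ, true_and] at hr ⊢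
        exact hr.trans_le (residueCount_le_add hy r)
      have hlt : (Finset.univ.filter fun r => j < s r).card < p := by
        have h := Finset.card_lt_univ_of_notMem
          (s := Finset.univ.filter fun r => j < s r) (x := r₀) (by simp; omega)
        rwa [ZMod.card] at h
      have hle := Finset.card_le_card hsub
      have hbpos := Finset.card_pos.2 hbne
      have hnat : (Finset.univ.filter fun r => j < a r).card + B.card ≤
          (Finset.univ.filter fun r => j < s r).card + 2 := by omega
      have hreal : ((Finset.univ.filter fun r => j < a r).card : ℝ) + B.card ≤
          (Finset.univ.filter fun r => j < s r).card + 2 := by exact_mod_cast hnat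
      linarith
    have hshift : ∀ j < m, ((Finset.univ.filter fun r => j < a r).card : ℝ) ≤
        (Finset.univ.filter fun r => j + 1 < s r).card := by
      intro j _
      refine Nat.cast_le.2 (Finset.card_le_card fun r hr => ?_)
      simp only [Finset.mem_filter, Finset.mem_univ, true_and] at hr ⊢
      have : a r < s r := residueCount_lt_add h0 hpB ((Nat.zero_le j).trans_lt hr)
      omega
    have hw := weighted_sum_le m hlevel hshift
    have hsumA : ∑ j ∈ Finset.range m, ((Finset.univ.filter fun r => j < a r).card : ℝ) =
        A.card := by
      rw [← sum_residueCount p A]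
      norm_cast
      rw [sum_card_superlevel]
      exact Finset.sum_congr rfl fun r _ => min_eq_right (hr₁ r (Finset.mem_univ _))
    have hsumS : ∑ j ∈ Finset.range (m + 1), ((Finset.univ.filter fun r => j < s r).card : ℝ) ≤
        (A + B).card := by
      rw [← sum_residueCount p (A + B)]
      norm_cast
      rw [sum_card_superlevel]
      exact Finset.sum_le_sum fun r _ => min_le_right _ _
    rw [hsumA] at hw
    have hm0 : (0 : ℝ) < m := by exact_mod_cast hmpos
    have hint : (0 : ℝ) ≤ ((K : ℝ) - m) * ((K : ℝ) - m - 1) := by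
      have : (0 : ℤ) ≤ ((K : ℤ) - m) * ((K : ℤ) - m - 1) := by
        rcases le_or_gt ((K : ℤ) - m) 0 with h | h
        · exact mul_nonneg_of_nonpos_of_nonpos h (by omega)
        · exact mul_nonneg h.le (by omega)
      exact_mod_cast this
    have hKβ : (A.card : ℝ) + K * β ≤ (A + B).card := by
      refine le_of_mul_le_mul_left ?_ hm0
      have := mul_le_mul_of_nonneg_left hsumS hm0.le
      nlinarith [mul_nonneg hint hβ0]
    linarith [min_le_right (p : ℝ) (K * β)]

end Residues

section Grid

/-- The indices of the cells `[c + i * h, c + (i + 1) * h)` that meet `S`. -/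
def gridIndices (c h : ℝ) (S : Set ℝ) : Set ℤ := (fun x => ⌊(x - c) / h⌋) '' S

lemma floor_div_eq_iff {c h x : ℝ} (hh : 0 < h) {i : ℤ} :
    ⌊(x - c) / h⌋ = i ↔ x ∈ Ico (c + i * h) (c + (i + 1) * h) := by
  rw [Int.floor_eq_iff, le_div_iff₀ hh, div_lt_iff₀ hh, mem_Ico]
  constructor <;> rintro ⟨h1, h2⟩ <;> constructor <;> linarith

lemma finite_gridIndices {c h : ℝ} (hh : 0 < h) {S : Set ℝ} (hS : IsCompact S) :
    (gridIndices c h S).Finite := by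
  obtain ⟨l, hl⟩ := hS.bddBelow
  obtain ⟨u, hu⟩ := hS.bddAbove
  refine (Set.finite_Icc ⌊(l - c) / h⌋ ⌊(u - c) / h⌋).subset ?_
  rintro _ ⟨x, hx, rfl⟩
  have h1 := hl hx
  have h2 := hu hx
  constructor <;> dsimp only <;> gcongr

lemma volume_biUnion_cells {h : ℝ} (hh : 0 < h) (c : ℝ) (I : Finset ℤ) :
    volume (⋃ i ∈ I, Ico (c + i * h) (c + (i + 1) * h)) = ENNReal.ofReal (I.card * h) := by
  rw [measure_biUnion_finset]
  · have : ∀ i ∈ I, volume (Ico (c + i * h) (c + (i + 1) * h)) = ENNReal.ofReal h := by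
      intro i _
      rw [Real.volume_Ico]
      congr 1
      ring
    rw [Finset.sum_congr rfl this, Finset.sum_const, nsmul_eq_mul,
      ENNReal.ofReal_mul (Nat.cast_nonneg _), ENNReal.ofReal_natCast]
  · intro i _ j _ hij
    refine Set.disjoint_left.2 fun x hi hj => hij ?_
    rw [← (floor_div_eq_iff hh).2 hi, (floor_div_eq_iff hh).2 hj]
  · exact fun i _ => measurableSet_Ico

lemma volume_le_card_gridIndices {c h : ℝ} (hh : 0 < h) {S : Set ℝ} {I : Finset ℤ}
    (hI : (I : Set ℤ) = gridIndices c h S) : (volume S).toReal ≤ I.card * h := by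
  have hsub : S ⊆ ⋃ i ∈ I, Ico (c + i * h) (c + (i + 1) * h) := by
    intro x hx
    have hmem : ⌊(x - c) / h⌋ ∈ I := by
      rw [← Finset.mem_coe, hI]
      exact ⟨x, hx, rfl⟩
    exact mem_biUnion hmem ((floor_div_eq_iff hh).1 rfl)
  refine ENNReal.toReal_le_of_le_ofReal (by positivity) ?_
  rw [← volume_biUnion_cells hh c]
  exact measure_mono hsub

lemma card_add_gridIndices_le {c h : ℝ} (hh : 0 < h) {A B : Set ℝ} (hA : IsCompact A)
    (hB : IsCompact B) {I J : Finset ℤ} (hI : (I : Set ℤ) = gridIndices 0 h A)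
    (hJ : (J : Set ℤ) = gridIndices c h B) :
    (I + J).card * h ≤ (volume (Metric.cthickening (2 * h) (A + B))).toReal := by
  have hsub : (⋃ k ∈ I + J, Ico (c + k * h) (c + (k + 1) * h)) ⊆
      Metric.cthickening (2 * h) (A + B) := by
    intro z hz
    simp only [mem_iUnion] at hz
    obtain ⟨k, hk, hz⟩ := hz
    obtain ⟨i, hi, j, hj, rfl⟩ := Finset.mem_add.1 hk
    rw [← Finset.mem_coe, hI] at hi
    rw [← Finset.mem_coe, hJ] at hj
    obtain ⟨x, hx, hxi⟩ := hi
    obtain ⟨y, hy, hyj⟩ := hj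
    have hxi := (floor_div_eq_iff hh).1 hxi
    have hyj := (floor_div_eq_iff hh).1 hyj
    rw [mem_Ico] at hxi hyj hz
    push_cast at hz
    refine Metric.mem_cthickening_of_dist_le z (x + y) _ _ (add_mem_add hx hy) ?_
    rw [Real.dist_eq, abs_le]
    constructor <;> nlinarith
  have hfin : volume (Metric.cthickening (2 * h) (A + B)) ≠ ⊤ :=
    (hA.add hB).isBounded.cthickening.measure_lt_top.ne
  rw [← ENNReal.ofReal_le_iff_le_toReal hfin, ← volume_biUnion_cells hh c]
  exact measure_mono hsub

end Grid

/-- An approximate form of Ruzsa's inequality, for a thickening of the sumset. -/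
lemma volume_add_min_le_volume_cthickening {A B : Set ℝ} (hA : IsCompact A) (hB : IsCompact B)
    (hAne : A.Nonempty) (hBne : B.Nonempty) (hD : 0 < sSup B - sInf B) {K : ℕ}
    (hK : (K : ℝ) * (K - 1) / 2 * (volume B).toReal ≤ (volume A).toReal) {p : ℕ}
    (hp : p.Prime) {h : ℝ} (hh : h = (sSup B - sInf B) / p)
    (hsmall : 2 * h ≤ (volume B).toReal) :
    (volume A).toReal + min (sSup B - sInf B) (K * ((volume B).toReal - 2 * h)) ≤
      (volume (Metric.cthickening (2 * h) (A + B))).toReal := by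
  have hp0 : (0 : ℝ) < p := by exact_mod_cast hp.pos
  have hh0 : 0 < h := hh ▸ div_pos hD hp0
  have hph : p * h = sSup B - sInf B := by rw [hh]; field_simp
  set c := sInf B with hc
  obtain ⟨I, hI⟩ := (finite_gridIndices (c := 0) hh0 hA).exists_finset_coe
  obtain ⟨J, hJ⟩ := (finite_gridIndices (c := c) hh0 hB).exists_finset_coe
  have hIne : I.Nonempty := by
    rw [← Finset.coe_nonempty, hI]
    exact hAne.image _
  have hJ0 : (0 : ℤ) ∈ J := by
    rw [← Finset.mem_coe, hJ]
    exact ⟨c, hB.sInf_mem hBne, by simp⟩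
  have hdiv : (sSup B - c) / h = p := by rw [← hph]; field_simp
  have hJp : (p : ℤ) ∈ J := by
    rw [← Finset.mem_coe, hJ]
    exact ⟨sSup B, hB.sSup_mem hBne, by simp [hdiv]⟩
  have hJsub : J ⊆ Finset.Icc 0 (p : ℤ) := by
    intro j hj
    rw [← Finset.mem_coe, hJ] at hj
    obtain ⟨x, hx, rfl⟩ := hj
    have h1 : c ≤ x := csInf_le hB.bddBelow hx
    have h2 : x ≤ sSup B := le_csSup hB.bddAbove hx
    rw [Finset.mem_Icc]
    refine ⟨Int.floor_nonneg.2 (div_nonneg (by linarith) hh0.le), ?_⟩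
    have h3 : (x - c) / h ≤ p := hdiv ▸ by gcongr
    simpa using Int.floor_le_floor h3
  have hIcard := volume_le_card_gridIndices hh0 hI
  have hJcard := volume_le_card_gridIndices hh0 hJ
  have hsum := card_add_gridIndices_le hh0 hA hB hI hJ
  set β := (volume B).toReal / h - 2 with hβdef
  have hβh : β * h = (volume B).toReal - 2 * h := by rw [hβdef]; field_simp
  have hβ0 : 0 ≤ β := by
    refine le_of_mul_le_mul_right ?_ hh0
    linarith
  have hβ : β + 2 ≤ J.card := by
    refine le_of_mul_le_mul_right ?_ hh0
    linarith
  have hKnn : (0 : ℝ) ≤ K * (K - 1) / 2 := by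
    rcases Nat.eq_zero_or_pos K with rfl | hKpos
    · simp
    · have : (1 : ℝ) ≤ K := by exact_mod_cast hKpos
      have : (0 : ℝ) ≤ K - 1 := by linarith
      positivity
  have hKI : (K : ℝ) * (K - 1) / 2 * β ≤ I.card := by
    refine le_of_mul_le_mul_right ?_ hh0
    rw [mul_assoc, hβh]
    have := mul_le_mul_of_nonneg_left
      (show (volume B).toReal - 2 * h ≤ (volume B).toReal by linarith) hKnn
    linarith
  have hdisc := mul_le_mul_of_nonneg_right
    (card_add_min_le_card_add hp hIne hJsub hJ0 hJp K hβ0 hβ hKI) hh0.le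
  rw [add_mul, min_mul_of_nonneg _ _ hh0.le, hph, mul_assoc, hβh] at hdisc
  linarith

/-- Consequence of Ruzsa's theorem (Theorem 1.2 and the following remark):
`λ(A+B) ≥ λ(A) + min(diam(B), K·λ(B))`. -/
theorem ruzsa_min_inequality (A B : Set ℝ) (hA : IsCompact A) (hB : IsCompact B)
    (hApos : 0 < volume A) (hBpos : 0 < volume B)
    (K : ℕ) (hK : 1 ≤ K)
    (hK1 : (K : ℝ) * ((K : ℝ) - 1) / 2 ≤ (volume A).toReal / (volume B).toReal)
    (hK2 : (volume A).toReal / (volume B).toReal < (K : ℝ) * ((K : ℝ) + 1) / 2) :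
    (volume (A + B)).toReal ≥
      (volume A).toReal + min (sSup B - sInf B) ((K : ℝ) * (volume B).toReal) := by
  have hAne : A.Nonempty := nonempty_of_measure_ne_zero hApos.ne'
  have hBne : B.Nonempty := nonempty_of_measure_ne_zero hBpos.ne'
  have hBreal : 0 < (volume B).toReal := ENNReal.toReal_pos hBpos.ne' hB.measure_lt_top.ne
  have hD : 0 < sSup B - sInf B := by
    have hsub : B ⊆ Icc (sInf B) (sSup B) :=
      fun x hx => ⟨csInf_le hB.bddBelow hx, le_csSup hB.bddAbove hx⟩
    have hpos := hBpos.trans_le (measure_mono hsub)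
    rwa [Real.volume_Icc, ENNReal.ofReal_pos] at hpos
  rw [le_div_iff₀ hBreal] at hK1
  let q : ℕ → ℕ := Nat.nth Nat.Prime
  let h : ℕ → ℝ := fun n => (sSup B - sInf B) / q n
  have hq : Filter.Tendsto (fun n => (q n : ℝ)) Filter.atTop Filter.atTop :=
    tendsto_natCast_atTop_atTop.comp
      (Nat.nth_strictMono Nat.infinite_setOfPred_prime).tendsto_atTop
  have hlim : Filter.Tendsto h Filter.atTop (nhds 0) := hq.const_div_atTop _
  have hlim2 : Filter.Tendsto (fun n => 2 * h n) Filter.atTop (nhds 0) := by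
    simpa using hlim.const_mul 2
  have hleft : Filter.Tendsto (fun n => (volume A).toReal +
      min (sSup B - sInf B) (K * ((volume B).toReal - 2 * h n))) Filter.atTop
      (nhds ((volume A).toReal + min (sSup B - sInf B) (K * (volume B).toReal))) := by
    have := (tendsto_const_nhds (x := (volume B).toReal)).sub hlim2
    rw [sub_zero] at this
    exact tendsto_const_nhds.add (tendsto_const_nhds.min (this.const_mul _))
  have hright : Filter.Tendsto
      (fun n => (volume (Metric.cthickening (2 * h n) (A + B))).toReal) Filter.atTop
      (nhds (volume (A + B)).toReal) :=
    (ENNReal.tendsto_toReal (hA.add hB).measure_lt_top.ne).comp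
      ((tendsto_measure_cthickening_of_isCompact (hA.add hB)).comp hlim2)
  refine le_of_tendsto_of_tendsto hleft hright ?_
  filter_upwards [hlim2.eventually (ge_mem_nhds hBreal)] with n hn
  exact volume_add_min_le_volume_cthickening hA hB hAne hBne hD hK1
    (Nat.prime_nth_prime n) rfl hn
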